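/- Let R : ℝ → ℝ be admissible, and let m ≥ 0 satisfy R′(m) ≥ δ. Then 0 ≤ m·R′(m) − R(m) ≤ −R(0). (Multiplied by 2π this is estimate (3.2): the function K_{τ_L} associated to a δ-wobbly Dehn twist, given by K_{τ_L}(ι(y)) = 2π(R′(‖y‖)·‖y‖ − R(‖y‖)), satisfies 0 ≤ K_{τ_L}(ι(y)) ≤ −2πR(0) at every point y with R′(‖y‖) ≥ δ.) -/

import Mathlib

/-! Estimate (3.2) of Seidel, "A long exact sequence for symplectic Floer cohomology"
(divided by 2π): for the angle function R of a δ-wobbly Dehn twist and a point m with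
R′(m) ≥ δ, one has 0 ≤ m·R′(m) − R(m) ≤ −R(0). -/

/-- The conditions on the angle function of a δ-wobbly model Dehn twist. -/
def Admissible (lam δ : ℝ) (R : ℝ → ℝ) : Prop :=
  ContDiff ℝ 2 R ∧
  (∀ t : ℝ, 0 ≤ t → 0 ≤ deriv R t) ∧
  (∀ t : ℝ, lam ≤ t → R t = 0) ∧
  (∀ t : ℝ, 0 ≤ t → δ ≤ deriv R t → deriv (deriv R) t < 0)

/-- If the derivative of `f` is negative wherever `f` takes the value `f m` on `[0, m]`,
then `f m` is the minimum of `f` on `[0, m]`. -/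
theorem le_of_deriv_neg_of_eq_right_endpoint {f : ℝ → ℝ} (hf : Differentiable ℝ f) {m : ℝ}
    (h : ∀ t ∈ Set.Icc 0 m, f t = f m → deriv f t < 0) {t : ℝ} (ht : t ∈ Set.Icc 0 m) :
    f m ≤ f t := by
  have hd (s : ℝ) : HasDerivAt (fun s => -f (m - s)) (deriv f (m - s)) s := by
    simpa using ((hf (m - s)).hasDerivAt.comp_const_sub m s).fun_neg
  have key := image_le_of_deriv_right_lt_deriv_boundary (a := 0) (b := m)
    (f := fun s => -f (m - s)) (f' := fun s => deriv f (m - s))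
    (B := fun _ => -f m) (B' := fun _ => 0)
    (fun s _ => (hd s).continuousAt.continuousWithinAt)
    (fun s _ => (hd s).hasDerivWithinAt) (by simp)
    (fun s => hasDerivAt_const s _)
    (fun s hs he => h _ ⟨sub_nonneg.2 hs.2.le, sub_le_self m hs.1⟩ (neg_injective he))
    (x := m - t) ⟨sub_nonneg.2 ht.2, sub_le_self m ht.1⟩
  simpa using key

theorem twist_function_estimate (lam δ : ℝ) (hlam : 0 < lam) (hδ0 : 0 < δ)
    (hδ : δ < 1/2) (R : ℝ → ℝ) (hR : Admissible lam δ R)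
    (m : ℝ) (hm : 0 ≤ m) (hm' : δ ≤ deriv R m) :
    0 ≤ m * deriv R m - R m ∧ m * deriv R m - R m ≤ -(R 0) := by
  obtain ⟨hC, hmono, hzero, hconc⟩ := hR
  have hd : Differentiable ℝ R := hC.differentiable (by norm_num)
  have hd' : Differentiable ℝ (deriv R) := hC.differentiable_deriv_two
  have hRm : R m ≤ 0 := by
    have hRmono : MonotoneOn R (Set.Ici 0) :=
      monotoneOn_of_deriv_nonneg (convex_Ici 0) hd.continuous.continuousOn hd.differentiableOn
        fun t ht => hmono t (interior_subset ht)
    exact (hRmono hm (hm.trans (le_max_left m lam)) (le_max_left m lam)).trans_eq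
      (hzero _ (le_max_right m lam))
  refine ⟨by linarith [mul_nonneg hm (hmono m hm)], ?_⟩
  have hslope : deriv R m * (m - 0) ≤ R m - R 0 :=
    (convex_Icc 0 m).mul_sub_le_image_sub_of_le_deriv hd.continuous.continuousOn
      hd.differentiableOn
      (fun t ht => le_of_deriv_neg_of_eq_right_endpoint hd'
        (fun s hs he => hconc s hs.1 (he ▸ hm')) (interior_subset ht))
      0 ⟨le_rfl, hm⟩ m ⟨hm, le_rfl⟩ hm
  linarith
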